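/- arXiv:2106.03789 — 3 statements merged into one kernel-verified Lean document; each statement's English description precedes it below -/
import Mathlib

section
/- Let S, t be integers with 2 ≤ t ≤ S, and set h_1 = ⌊S/t⌋, h_2 = h_1 + 1, d = S − t·⌊S/t⌋ (the remainder of S modulo t), and c = t − d. Then the maximum of the continuant ⟨a_1,…,a_t⟩ over the set U(S,t) of all sequences of t positive integers with sum S equals ⟨h_1, h_1, …, h_1⟩ (t copies of h_1) if t divides S, and equals ⟨h_2, h_1^{c}, h_2^{d−1}⟩ (i.e. one h_2, then c copies of h_1, then d−1 copies of h_2) otherwise. -/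
/-- The continuant of a finite sequence of positive integers. -/
def contnt : List ℕ → ℕ
  | [] => 1
  | [a] => a
  | a :: b :: l => a * contnt (b :: l) + contnt l

/-- The product of the matrices `!![a, 1; 1, 0]` over the entries `a` of a list; its entries are
the continuants of the list and of its truncations. -/
def contntMatrix (l : List ℕ) : Matrix (Fin 2) (Fin 2) ℕ :=
  (l.map fun a => !![a, 1; 1, 0]).prod

namespace contntMatrix

open List

@[simp] lemma nil : contntMatrix [] = 1 := rfl

lemma cons (a : ℕ) (l : List ℕ) :
    contntMatrix (a :: l) = !![a, 1; 1, 0] * contntMatrix l := by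
  simp [contntMatrix]

lemma append (l m : List ℕ) :
    contntMatrix (l ++ m) = contntMatrix l * contntMatrix m := by
  simp [contntMatrix]

lemma reverse (l : List ℕ) :
    contntMatrix l.reverse = (contntMatrix l).transpose := by
  induction l with
  | nil => simp
  | cons a l ih =>
    rw [reverse_cons, append, ih, cons a l, cons, nil, Matrix.transpose_mul, mul_one]
    congr 1
    ext i j
    fin_cases i <;> fin_cases j <;> rfl

lemma cons_zero (a : ℕ) (l : List ℕ) (j : Fin 2) :
    contntMatrix (a :: l) 0 j = a * contntMatrix l 0 j + contntMatrix l 1 j := by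
  simp [cons, Matrix.mul_apply, Fin.sum_univ_two]

lemma cons_one (a : ℕ) (l : List ℕ) (j : Fin 2) :
    contntMatrix (a :: l) 1 j = contntMatrix l 0 j := by
  simp [cons, Matrix.mul_apply, Fin.sum_univ_two]

lemma concat_zero (a : ℕ) (l : List ℕ) (i : Fin 2) :
    contntMatrix (l ++ [a]) i 0 = a * contntMatrix l i 0 + contntMatrix l i 1 := by
  simp [append, cons, Matrix.mul_apply, Fin.sum_univ_two, mul_comm]

lemma concat_one (a : ℕ) (l : List ℕ) (i : Fin 2) :
    contntMatrix (l ++ [a]) i 1 = contntMatrix l i 0 := by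
  simp [append, cons, Matrix.mul_apply, Fin.sum_univ_two]

lemma contnt_eq : ∀ l : List ℕ, contnt l = contntMatrix l 0 0
  | [] => by simp [contnt]
  | [a] => by simp [contnt, cons]
  | a :: b :: l => by
    rw [contnt, contnt_eq (b :: l), contnt_eq l, cons_zero a, cons_one]

lemma one_zero_le {l : List ℕ} (hl : ∀ y ∈ l, 1 ≤ y) :
    contntMatrix l 1 0 ≤ contntMatrix l 0 0 := by
  cases l with
  | nil => simp
  | cons a l =>
    rw [cons_one, cons_zero]
    have := hl a (by simp)
    nlinarith [Nat.zero_le (contntMatrix l 0 0)]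

lemma zero_one_le {l : List ℕ} (hl : ∀ y ∈ l, 1 ≤ y) :
    contntMatrix l 0 1 ≤ contntMatrix l 0 0 := by
  have := one_zero_le (l := l.reverse) (by simpa using hl)
  simpa [reverse] using this

lemma one_zero_eq_of_reverse_eq {l : List ℕ} (hl : l.reverse = l) :
    contntMatrix l 1 0 = contntMatrix l 0 1 := by
  conv_lhs => rw [← hl, reverse, Matrix.transpose_apply]

lemma append_append_zero_zero (P W Q : List ℕ) :
    contntMatrix (P ++ (W ++ Q)) 0 0 =
      contntMatrix P 0 0 *
        (contntMatrix W 0 0 * contntMatrix Q 0 0 + contntMatrix W 0 1 * contntMatrix Q 1 0) +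
      contntMatrix P 0 1 *
        (contntMatrix W 1 0 * contntMatrix Q 0 0 + contntMatrix W 1 1 * contntMatrix Q 1 0) := by
  simp [append, Matrix.mul_apply, Fin.sum_univ_two]

end contntMatrix

open List contntMatrix

lemma contnt_reverse (l : List ℕ) : contnt l.reverse = contnt l := by
  simp [contnt_eq, contntMatrix.reverse]

/-- Reversing a block does not decrease the continuant when the block and its surroundings are
oppositely oriented. -/
lemma contnt_le_reverse_block {P W Q : List ℕ}
    (hW : contntMatrix W 1 0 ≤ contntMatrix W 0 1)
    (hPQ : contntMatrix P 0 0 * contntMatrix Q 1 0 ≤ contntMatrix P 0 1 * contntMatrix Q 0 0) :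
    contnt (P ++ (W ++ Q)) ≤ contnt (P ++ (W.reverse ++ Q)) := by
  simp only [contnt_eq, append_append_zero_zero, contntMatrix.reverse, Matrix.transpose_apply]
  obtain ⟨u, hu⟩ := Nat.exists_eq_add_of_le hW
  rw [hu]
  nlinarith [Nat.mul_le_mul_left u hPQ]

/-- Moving a unit from `x + 1` to `y < x` across a palindromic block does not decrease the
continuant. -/
lemma contnt_le_transfer {P W Q : List ℕ} {x y : ℕ} (hxy : y + 1 ≤ x) (hW : W.reverse = W)
    (hQ : ∀ z ∈ Q, 1 ≤ z) :
    contnt (P ++ (((x + 1) :: W ++ [y]) ++ Q)) ≤ contnt (P ++ ((x :: W ++ [y + 1]) ++ Q)) := by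
  obtain ⟨e, rfl⟩ := Nat.exists_eq_add_of_le hxy
  obtain ⟨u, hu⟩ := Nat.exists_eq_add_of_le (one_zero_le hQ)
  rw [contnt_eq, contnt_eq, append_append_zero_zero, append_append_zero_zero]
  simp only [cons_append, cons_zero, cons_one, concat_zero, concat_one,
    one_zero_eq_of_reverse_eq hW, hu]
  refine le_iff_exists_add.mpr ⟨contntMatrix P 0 0 * contntMatrix W 0 0 *
    (e * contntMatrix Q 0 0 + u) + contntMatrix P 0 1 * contntMatrix W 0 0 * contntMatrix Q 0 0, ?_⟩
  rw [hu]
  ring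

/-- A list with two entries differing by at least two contains such a pair with only copies of a
single number between them. -/
lemma exists_unbalanced_block (l : List ℕ) :
    (∀ x ∈ l, ∀ y ∈ l, x ≤ y + 1) ∨
      ∃ P W Q x y, l = P ++ ((x :: W ++ [y]) ++ Q) ∧ W.reverse = W ∧ (x + 2 ≤ y ∨ y + 2 ≤ x) := by
  induction l with
  | nil => simp
  | cons a l ih =>
    rcases ih with hl | ⟨P, W, Q, x, y, rfl, h⟩
    · by_cases ha : ∀ z ∈ l, a ≤ z + 1 ∧ z ≤ a + 1
      · left
        simp only [mem_cons]
        rintro x (rfl | hx) y (rfl | hy)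
        · omega
        · exact (ha y hy).1
        · exact (ha x hx).2
        · exact hl x hx y hy
      · right
        have key : ∀ m : List ℕ, (¬ ∀ z ∈ m, a ≤ z + 1 ∧ z ≤ a + 1) →
            ∃ W y Q, m = W ++ y :: Q ∧ (∀ z ∈ W, a ≤ z + 1 ∧ z ≤ a + 1) ∧
              (a + 2 ≤ y ∨ y + 2 ≤ a) := by
          intro m
          induction m with
          | nil => simp
          | cons b m ihm =>
            intro h
            by_cases hb : a ≤ b + 1 ∧ b ≤ a + 1
            · obtain ⟨W, y, Q, rfl, hW, hy⟩ := ihm fun hm => h (by simpa [hb] using hm)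
              exact ⟨b :: W, y, Q, rfl, by simpa [hb] using hW, hy⟩
            · exact ⟨[], b, m, rfl, by simp, by omega⟩
        obtain ⟨W, y, Q, rfl, hW, hy⟩ := key l ha
        refine ⟨[], W, Q, a, y, by simp, ?_, hy⟩
        have hrep : W = replicate W.length (min a y + 1) := by
          refine eq_replicate_of_mem fun z hz => ?_
          have h1 := hW z hz
          have h2 := hl z (by simp [hz]) y (by simp)
          have h3 := hl y (by simp) z (by simp [hz])
          omega
        rw [hrep, reverse_replicate]
    · exact Or.inr ⟨a :: P, W, Q, x, y, rfl, h⟩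

/-- Some balanced list of the same length and sum has at least as large a continuant. -/
lemma exists_balanced_contnt_le (l : List ℕ) (hl : ∀ y ∈ l, 1 ≤ y) :
    ∃ m : List ℕ, m.length = l.length ∧ m.sum = l.sum ∧ (∀ y ∈ m, 1 ≤ y) ∧
      (∀ x ∈ m, ∀ y ∈ m, x ≤ y + 1) ∧ contnt l ≤ contnt m := by
  induction hn : (l.map (· ^ 2)).sum using Nat.strong_induction_on generalizing l with
  | _ n ih =>
  rcases exists_unbalanced_block l with hb | ⟨P, W, Q, x, y, rfl, hW, hxy⟩
  · exact ⟨l, rfl, rfl, hl, hb, le_rfl⟩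
  subst hn
  have hP : ∀ z ∈ P, 1 ≤ z := fun z hz => hl z (by simp [hz])
  have hQ : ∀ z ∈ Q, 1 ≤ z := fun z hz => hl z (by simp [hz])
  have hW' : ∀ z ∈ W, 1 ≤ z := fun z hz => hl z (by simp [hz])
  have hx : 1 ≤ x := hl x (by simp)
  have hy : 1 ≤ y := hl y (by simp)
  obtain ⟨x', y', hx', hy', hs, hsq, hle⟩ : ∃ x' y', 1 ≤ x' ∧ 1 ≤ y' ∧ x' + y' = x + y ∧
      x' ^ 2 + y' ^ 2 < x ^ 2 + y ^ 2 ∧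
      contnt (P ++ ((x :: W ++ [y]) ++ Q)) ≤ contnt (P ++ ((x' :: W ++ [y']) ++ Q)) := by
    rcases hxy with h | h
    · obtain ⟨y, rfl⟩ := Nat.exists_eq_add_of_le' hy
      refine ⟨x + 1, y, by omega, by omega, by omega, by nlinarith, ?_⟩
      have := contnt_le_transfer (P := Q.reverse) (Q := P.reverse) (x := y) (y := x) (by omega) hW
        (by simpa using hP)
      rw [← contnt_reverse, ← contnt_reverse (P ++ ((x + 1) :: W ++ [y] ++ Q))]
      simpa [hW] using this
    · obtain ⟨x, rfl⟩ := Nat.exists_eq_add_of_le' hx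
      exact ⟨x, y + 1, by omega, by omega, by omega, by nlinarith,
        contnt_le_transfer (by omega) hW hQ⟩
  obtain ⟨m, h1, h2, h3, h4, h5⟩ := ih _ (by simp; omega) (P ++ ((x' :: W ++ [y']) ++ Q))
    (by
      simp only [cons_append, mem_append, mem_cons, not_mem_nil, or_false]
      rintro z (h | rfl | (h | rfl) | h)
      exacts [hP z h, hx', hW' z h, hy', hQ z h]) rfl
  refine ⟨m, by simpa using h1, ?_, h3, h4, hle.trans h5⟩
  simp at h2 ⊢
  omega

lemma replicate_append_orientation {h : ℕ} (hh : 1 ≤ h) (j k : ℕ) :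
    contntMatrix (replicate j (h + 1) ++ replicate k h) 1 0 ≤
      contntMatrix (replicate j (h + 1) ++ replicate k h) 0 1 := by
  rcases j with _ | j
  · exact (one_zero_eq_of_reverse_eq (by simp)).le
  rcases k with _ | k
  · exact (one_zero_eq_of_reverse_eq (by simp)).le
  have hV : ∀ y ∈ replicate j (h + 1) ++ replicate k h, 1 ≤ y := by
    simp only [mem_append, mem_replicate]
    omega
  have hle := zero_one_le hV
  rw [replicate_succ' (n := k), ← append_assoc, concat_one, replicate_succ, cons_append, cons_append,
    cons_one, cons_zero, concat_zero]
  nlinarith [Nat.zero_le (contntMatrix (replicate j (h + 1) ++ replicate k h) 1 0)]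

lemma cons_replicate_bound {h : ℕ} (hh : 1 ≤ h) (i : ℕ) :
    contntMatrix ((h + 1) :: replicate i h) 0 0 ≤
      contntMatrix ((h + 1) :: replicate i h) 0 1 * (h + 1) := by
  rcases i with _ | i
  · simp [cons_zero]
  have hV : ∀ y ∈ (h + 1) :: replicate i h, 1 ≤ y := by
    simp only [mem_cons, mem_replicate]
    omega
  have := zero_one_le hV
  rw [replicate_succ', ← cons_append, concat_zero, concat_one]
  nlinarith

/-- Bringing the smaller value forward after an initial larger value does not decrease the
continuant. -/
lemma contnt_le_sorted_tail {h : ℕ} (hh : 1 ≤ h) (Q : List ℕ) (hQ : ∀ y ∈ Q, y = h ∨ y = h + 1)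
    (i j k : ℕ) :
    contnt (((h + 1) :: replicate i h) ++ ((replicate j (h + 1) ++ replicate k h) ++ Q)) ≤
      contnt ((h + 1) :: (replicate (i + k + Q.count h) h ++
        replicate (j + Q.count (h + 1)) (h + 1))) := by
  induction Q generalizing i j k with
  | nil =>
    refine (contnt_le_reverse_block (replicate_append_orientation hh j k) (by simp)).trans
      (le_of_eq ?_)
    simp [← append_assoc]
  | cons b Q ih =>
    have hQ' : ∀ y ∈ Q, y = h ∨ y = h + 1 := fun y hy => hQ y (by simp [hy])
    rcases hQ b (by simp) with rfl | rfl
    · refine le_trans (le_of_eq ?_) ((ih hQ' i j (k + 1)).trans (le_of_eq ?_))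
      · simp [replicate_succ']
      · simp
        congr 4
        omega
    · refine (contnt_le_reverse_block (replicate_append_orientation hh j k) ?_).trans ?_
      · rw [cons_one (h + 1) Q, cons_zero (h + 1) Q]
        nlinarith [Nat.mul_le_mul_right (contntMatrix Q 0 0) (cons_replicate_bound hh i)]
      · refine le_trans (le_of_eq ?_) ((ih hQ' (i + k) (j + 1) 0).trans (le_of_eq ?_))
        · rw [replicate_succ' (n := j)]
          simp [← append_assoc]
          simp
        · simp
          congr 4
          omega

lemma contnt_le_of_two_values {h : ℕ} (hh : 1 ≤ h) (l : List ℕ) (hl : ∀ y ∈ l, y = h ∨ y = h + 1)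
    (hmem : h + 1 ∈ l) :
    contnt l ≤ contnt ((h + 1) :: (replicate (l.count h) h ++
      replicate (l.count (h + 1) - 1) (h + 1))) := by
  obtain ⟨V, Q, rfl, hV⟩ := eq_append_cons_of_mem hmem
  obtain ⟨k, rfl⟩ : ∃ k, V = replicate k h := ⟨V.length, eq_replicate_of_mem fun z hz =>
    (hl z (by simp [hz])).resolve_right fun h => hV (h ▸ hz)⟩
  calc contnt (replicate k h ++ (h + 1) :: Q)
      = contnt (Q.reverse ++ ((replicate 1 (h + 1) ++ replicate k h) ++ [])) := by
        rw [← contnt_reverse]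
        simp
    _ ≤ contnt (Q.reverse ++ ((replicate 1 (h + 1) ++ replicate k h).reverse ++ [])) :=
        contnt_le_reverse_block (replicate_append_orientation hh 1 k) (by simp)
    _ = contnt (((h + 1) :: replicate k h) ++ ((replicate 0 (h + 1) ++ replicate 0 h) ++ Q)) := by
        rw [← contnt_reverse]
        simp
    _ ≤ _ := contnt_le_sorted_tail hh Q (fun y hy => hl y (by simp [hy])) k 0 0
    _ = _ := by simp [count_replicate]

lemma length_and_sum_of_two_values {h : ℕ} (l : List ℕ) (hl : ∀ y ∈ l, y = h ∨ y = h + 1) :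
    l.length = l.count h + l.count (h + 1) ∧ l.sum = l.length * h + l.count (h + 1) := by
  induction l with
  | nil => simp
  | cons b l ih =>
    obtain ⟨h1, h2⟩ := ih fun y hy => hl y (by simp [hy])
    rcases hl b (by simp) with rfl | rfl <;> simp [h2, add_mul] <;> omega

/-- The entries of a balanced list are the rounded-down average of the list or its successor,
which occurs as often as the remainder says. -/
lemma eq_div_or_eq_div_add_one {l : List ℕ} (hne : l ≠ [])
    (hl : ∀ x ∈ l, ∀ y ∈ l, x ≤ y + 1) :
    (∀ y ∈ l, y = l.sum / l.length ∨ y = l.sum / l.length + 1) ∧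
      l.count (l.sum / l.length + 1) = l.sum % l.length := by
  obtain ⟨m, hm, hmin⟩ : ∃ m ∈ l, ∀ y ∈ l, m ≤ y := by
    obtain ⟨m, hm⟩ := Option.isSome_iff_exists.mp (isSome_min?_of_ne_nil hne)
    exact ⟨m, (min?_eq_some_iff.mp hm).1, (min?_eq_some_iff.mp hm).2⟩
  have htwo : ∀ y ∈ l, y = m ∨ y = m + 1 := fun y hy => by
    have := hmin y hy
    have := hl y hy m hm
    omega
  obtain ⟨h1, h2⟩ := length_and_sum_of_two_values l htwo
  have hpos : 0 < l.count m := count_pos_iff.mpr hm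
  have hlt : l.count (m + 1) < l.length := by omega
  have hdiv : l.sum / l.length = m := by
    rw [h2, Nat.mul_add_div (by omega), Nat.div_eq_of_lt hlt, add_zero]
  rw [hdiv]
  refine ⟨htwo, ?_⟩
  rw [h2, Nat.mul_add_mod, Nat.mod_eq_of_lt hlt]

/-- Theorem 5: for `2 ≤ t ≤ S`, the maximum of the continuant over
`U(S,t)` (sequences of `t` positive integers with sum `S`) is `⟨h₁^t⟩` if `t ∣ S`
and `⟨h₂, h₁^c, h₂^{d−1}⟩` otherwise, where `h₁ = ⌊S/t⌋`, `h₂ = h₁+1`,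
`d = S − t⌊S/t⌋` and `c = t − d`. -/
theorem stmt_4 (S t : ℕ) (ht : 2 ≤ t) (htS : t ≤ S) :
    let h₁ := S / t
    let h₂ := h₁ + 1
    let d := S - t * (S / t)
    let c := t - d
    let M : List ℕ := if S % t = 0 then List.replicate t h₁
      else h₂ :: (List.replicate c h₁ ++ List.replicate (d - 1) h₂)
    (M.length = t ∧ M.sum = S ∧ ∀ y ∈ M, 1 ≤ y) ∧
    ∀ a : List ℕ, a.length = t → a.sum = S → (∀ y ∈ a, 1 ≤ y) →
      contnt a ≤ contnt M := by
  intro h₁ h₂ d c M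
  have hh : 1 ≤ h₁ := (Nat.one_le_div_iff (by omega)).mpr htS
  have hS : t * h₁ + S % t = S := Nat.div_add_mod S t
  have hd : d = S % t := by
    change S - t * h₁ = _
    omega
  have hlt : S % t < t := Nat.mod_lt S (by omega)
  refine ⟨?_, fun a hlen hsum hpos => ?_⟩
  · by_cases hr : S % t = 0
    · have hM : M = replicate t h₁ := if_pos hr
      rw [hM]
      refine ⟨by simp, ?_, fun y hy => (eq_of_mem_replicate hy).symm ▸ hh⟩
      rw [sum_replicate, smul_eq_mul]
      omega
    · have hM : M = h₂ :: (replicate c h₁ ++ replicate (d - 1) h₂) := if_neg hr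
      obtain ⟨e, he⟩ := Nat.exists_eq_succ_of_ne_zero (hd ▸ hr)
      have hc : c + e + 1 = t := by
        change t - d + e + 1 = t
        omega
      rw [hM]
      refine ⟨?_, ?_, ?_⟩
      · simp [he]
        omega
      · rw [← hS, ← hd, ← hc, he]
        simp [h₂]
        ring
      · simp only [mem_cons, mem_append, mem_replicate, h₂]
        omega
  · obtain ⟨b, hblen, hbsum, -, hbal, hle⟩ := exists_balanced_contnt_le a hpos
    refine hle.trans ?_
    have hbt : b.length = t := hblen.trans hlen
    have hne : b ≠ [] := by
      rintro rfl
      simp at hbt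
      omega
    obtain ⟨htwo, hcount⟩ := eq_div_or_eq_div_add_one hne hbal
    rw [hbsum, hsum, hbt] at htwo hcount
    have hcount' := (length_and_sum_of_two_values b htwo).1
    by_cases hr : S % t = 0
    · have hM : M = replicate t h₁ := if_pos hr
      rw [hM, ← hbt]
      refine (congrArg contnt (eq_replicate_of_mem fun y hy => ?_)).le
      refine (htwo y hy).resolve_right fun h => ?_
      rw [hr, count_eq_zero] at hcount
      exact hcount (h ▸ hy)
    · have hM : M = h₂ :: (replicate c h₁ ++ replicate (d - 1) h₂) := if_neg hr
      have hc : c = b.count h₁ := by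
        change t - d = b.count (S / t)
        omega
      rw [hM, hc, hd, ← hcount]
      exact contnt_le_of_two_values hh b htwo (count_pos_iff.mp (by
        rw [hcount]
        exact Nat.pos_of_ne_zero hr))
end

section
/- Let n ≥ 2 and S ≥ 2n+2 be integers. For z ∈ {1,…,n−1} let x = x(z) be the unique integer with 0 ≤ x ≤ n and x ≡ z − S (mod n+1), let m(z) = (S − z − n·x(z))/(n+1), and let P*(S) = {z ∈ P(S) : m(z) ≥ 1}. Then the minimum of the continuant ⟨a_1,…,a_t⟩ over the set U_n(S) equals min over z ∈ P*(S) of T_z(m(z), x(z)). -/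
/-- The middle block `N_z(x)`: `(n^{x}, z)` for `x ≥ 0` and `(1^{−1−x}, z, 1)` for `x < 0`. -/
def Nseq (n z : ℕ) (x : ℤ) : List ℕ :=
  if 0 ≤ x then List.replicate x.toNat n ++ [z]
  else List.replicate (-1 - x).toNat 1 ++ [z, 1]

/-- The sequence whose continuant is `T_z(m,x)`. -/
def TzSeq (n z m : ℕ) (x : ℤ) : List ℕ :=
  ((List.range (2 * (m - m / 2))).map fun i => if i % 2 = 0 then 1 else n) ++
    Nseq n z x ++
    ((List.range (2 * (m / 2))).map fun i => if i % 2 = 0 then n else 1)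

/-- `S₀⁽ⁿ⁾ = (n+1)·{(S−1)/(n+1)} + 1`. -/
def Szero (n S : ℕ) : ℕ := (S - 1) % (n + 1) + 1

/-- `S₁⁽ⁿ⁾ = n·{S/n}`. -/
def Sone (n S : ℕ) : ℕ := S % n

/-- The set `P(S)` from (8). -/
def Pset (n S : ℕ) : Finset ℕ :=
  if n ^ 2 - 1 ≤ S then Finset.Icc 1 (n - 1)
  else if Szero n S ≤ Sone n S then Finset.Icc (Szero n S) (Sone n S)
  else Finset.Icc 1 (Sone n S) ∪ Finset.Icc (Szero n S) (n - 1)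

/-- `x(z)`: the unique `0 ≤ x ≤ n` with `x ≡ z − S (mod n+1)`. -/
def xz (n S z : ℕ) : ℤ := ((z : ℤ) - S) % ((n : ℤ) + 1)

/-- `m(z) = (S − z − n·x(z))/(n+1)`. -/
def mz (n S z : ℕ) : ℤ := ((S : ℤ) - z - n * xz n S z) / ((n : ℤ) + 1)

/-- `P*(S) = {z ∈ P(S) : m(z) ≥ 1}`. -/
def Pstar (n S : ℕ) : Finset ℕ := (Pset n S).filter fun z => 1 ≤ mz n S z

/-- The continuant of the tail of a list, with value `0` at the empty list. -/
def contntTail : List ℕ → ℕ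
  | [] => 0
  | _ :: l => contnt l

@[simp] theorem contnt_nil : contnt [] = 1 := rfl

@[simp] theorem contntTail_nil : contntTail [] = 0 := rfl

@[simp] theorem contntTail_cons (a : ℕ) (l : List ℕ) : contntTail (a :: l) = contnt l := rfl

@[simp] theorem contnt_cons (a : ℕ) (l : List ℕ) :
    contnt (a :: l) = a * contnt l + contntTail l := by
  cases l <;> simp [contnt]

theorem contnt_reverse_append (X C : List ℕ) :
    contnt (X.reverse ++ C) = contnt X * contnt C + contntTail X * contntTail C := by
  induction X generalizing C with
  | nil => simp
  | cons a X ih =>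
    rw [List.reverse_cons, List.append_assoc, ih]
    simp
    ring

@[simp] theorem contnt_reverse_s6 (X : List ℕ) : contnt X.reverse = contnt X := by
  simpa using contnt_reverse_append X []

theorem contnt_append (X C : List ℕ) :
    contnt (X ++ C) = contnt X * contnt C + contntTail X.reverse * contntTail C := by
  simpa using contnt_reverse_append X.reverse C

theorem contnt_block (X D C : List ℕ) (b b' : ℕ) :
    contnt (X.reverse ++ b :: (D ++ b' :: C)) =
      contnt X * (contnt (b :: (D ++ [b'])) * contnt C + (b * contnt D + contntTail D) * contntTail C)
        + contntTail X * ((b' * contnt D + contntTail D.reverse) * contnt C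
          + contnt D * contntTail C) := by
  have h1 : b :: (D ++ b' :: C) = (b :: (D ++ [b'])) ++ C := by simp
  have h2 : contnt (b :: (D ++ [b']) ++ C) = contnt (b :: (D ++ [b'])) * contnt C +
      (b * contnt D + contntTail D) * contntTail C := by
    rw [contnt_append]
    simp only [List.reverse_cons, List.reverse_append, List.reverse_nil, List.nil_append,
      List.cons_append, contntTail_cons]
    rw [contnt_append, contnt_reverse_s6, List.reverse_reverse]
    simp only [contnt_cons, contnt_nil, contntTail_cons, contntTail_nil]
    ring
  have h3 : contntTail (b :: (D ++ b' :: C)) =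
      (b' * contnt D + contntTail D.reverse) * contnt C + contnt D * contntTail C := by
    rw [contntTail_cons, contnt_append]
    simp
    ring
  rw [contnt_reverse_append, h3, h1, h2]

theorem contnt_pos {l : List ℕ} (h : ∀ y ∈ l, 1 ≤ y) : 0 < contnt l := by
  induction l with
  | nil => simp
  | cons a l ih =>
    simp only [List.forall_mem_cons] at h
    have := Nat.mul_pos h.1 (ih h.2)
    rw [contnt_cons]
    omega

theorem contntTail_le {l : List ℕ} (h : ∀ y ∈ l, 1 ≤ y) : contntTail l ≤ contnt l := by
  cases l with
  | nil => simp
  | cons a l =>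
    simp only [List.forall_mem_cons] at h
    rw [contnt_cons, contntTail_cons]
    nlinarith [h.1, Nat.zero_le (contnt l)]

theorem contntTail_pos {l : List ℕ} (h : ∀ y ∈ l, 1 ≤ y) (hl : l ≠ []) : 0 < contntTail l := by
  cases l with
  | nil => exact absurd rfl hl
  | cons a l =>
    simp only [List.forall_mem_cons] at h
    exact contnt_pos h.2

/-- `CFGt X C` says that the continued fraction `[x₁; x₂, …]` exceeds `[c₁; c₂, …]`,
the value of the empty continued fraction being `∞`. -/
def CFGt (X C : List ℕ) : Prop := contntTail X * contnt C < contnt X * contntTail C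

theorem cfGt_cons_iff (a : ℕ) (X C : List ℕ) : CFGt (a :: X) (a :: C) ↔ CFGt C X := by
  simp only [CFGt, contnt_cons, contntTail_cons]
  constructor <;> intro h <;> nlinarith

theorem CFGt.of_head {x c : ℕ} {X C : List ℕ} (hX : ∀ y ∈ X, 1 ≤ y) (hC : ∀ y ∈ C, 1 ≤ y)
    (hne : X ≠ []) (hxc : c < x) : CFGt (x :: X) (c :: C) := by
  simp only [CFGt, contnt_cons, contntTail_cons]
  have h1 := Nat.mul_pos (contntTail_pos hX hne) (contnt_pos hC)
  have h2 := Nat.mul_le_mul_left (contnt X) (contntTail_le hC)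
  have h3 := Nat.mul_le_mul_right (contnt X * contnt C) hxc
  rw [Nat.succ_mul] at h3
  nlinarith

/-- The list `a, b, a, b, …` consisting of `k` copies of `a, b`. -/
def altList (a b : ℕ) : ℕ → List ℕ
  | 0 => []
  | k + 1 => a :: b :: altList a b k

theorem altList_add (a b j k : ℕ) : altList a b (j + k) = altList a b j ++ altList a b k := by
  induction j with
  | zero => simp [altList]
  | succ j ih => rw [Nat.add_right_comm]; simp [altList, ih]

theorem altList_succ' (a b k : ℕ) : altList a b (k + 1) = altList a b k ++ [a, b] :=
  altList_add a b k 1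

@[simp] theorem altList_reverse (a b k : ℕ) : (altList a b k).reverse = altList b a k := by
  induction k with
  | zero => rfl
  | succ k ih => rw [altList_succ', List.reverse_append, ih]; rfl

theorem cons_altList (a b k : ℕ) : a :: altList b a k = altList a b k ++ [a] := by
  induction k with
  | zero => rfl
  | succ k ih => simp [altList, ih]

theorem forall_mem_altList {a b : ℕ} {P : ℕ → Prop} (ha : P a) (hb : P b) (k : ℕ) :
    ∀ y ∈ altList a b k, P y := by
  induction k with
  | zero => simp [altList]
  | succ k ih => simp [altList, ha, hb]; exact ih

theorem sum_altList (a b k : ℕ) : (altList a b k).sum = k * (a + b) := by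
  induction k with
  | zero => simp [altList]
  | succ k ih => simp [altList, ih]; ring

theorem cfGt_altList {n j k : ℕ} (hn : 1 ≤ n) (hjk : j < k) :
    CFGt (altList n 1 j) (altList n 1 k) := by
  induction j generalizing k with
  | zero =>
    obtain ⟨k, rfl⟩ := Nat.exists_eq_add_of_lt hjk
    have : 0 < contntTail (altList n 1 (0 + k + 1)) :=
      contntTail_pos (forall_mem_altList hn le_rfl _) (by simp [altList])
    simpa [CFGt, altList] using this
  | succ j ih =>
    obtain ⟨k, rfl⟩ : ∃ k', k = k' + 1 := ⟨k - 1, by omega⟩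
    rw [altList, altList, cfGt_cons_iff, cfGt_cons_iff]
    exact ih (by omega)

/-- `a` minimises the continuant among sequences with entries in `{1, …, n}` and sum `S`. -/
structure IsMinSeq (n S : ℕ) (a : List ℕ) : Prop where
  bounds : ∀ y ∈ a, 1 ≤ y ∧ y ≤ n
  sum_eq : a.sum = S
  le : ∀ b : List ℕ, (∀ y ∈ b, 1 ≤ y ∧ y ≤ n) → b.sum = S → contnt a ≤ contnt b

theorem exists_isMinSeq {n : ℕ} (hn : 1 ≤ n) (S : ℕ) : ∃ a, IsMinSeq n S a := by
  classical
  have hne : ∃ v, ∃ a : List ℕ, (∀ y ∈ a, 1 ≤ y ∧ y ≤ n) ∧ a.sum = S ∧ contnt a = v :=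
    ⟨_, List.replicate S 1, by simpa using fun _ => hn, by simp, rfl⟩
  obtain ⟨a, h1, h2, h3⟩ := Nat.find_spec hne
  exact ⟨a, h1, h2, fun b hb hs => h3 ▸ Nat.find_min' hne ⟨b, hb, hs, rfl⟩⟩

namespace IsMinSeq

variable {n S : ℕ} {a : List ℕ}

theorem of_contnt_eq (h : IsMinSeq n S a) {b : List ℕ} (hb : ∀ y ∈ b, 1 ≤ y ∧ y ≤ n)
    (hs : b.sum = S) (hab : contnt b = contnt a) : IsMinSeq n S b :=
  ⟨hb, hs, fun c hc hcs => hab ▸ h.le c hc hcs⟩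

protected theorem reverse (h : IsMinSeq n S a) : IsMinSeq n S a.reverse :=
  h.of_contnt_eq (by simpa using h.bounds) (by simpa using h.sum_eq) (by simp)

/-- Reversing an inner block of a minimiser does not decrease the continuant. -/
theorem not_cfGt_of_lt {X D C : List ℕ} {b b' : ℕ}
    (h : IsMinSeq n S (X.reverse ++ b :: (D ++ b' :: C))) (hb : b' < b) : ¬ CFGt X C := by
  intro hR
  have hperm : (X.reverse ++ b' :: (D.reverse ++ b :: C)).Perm
      (X.reverse ++ b :: (D ++ b' :: C)) := by
    refine List.Perm.append_left _ ?_
    rw [← Multiset.coe_eq_coe]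
    simp only [← Multiset.cons_coe, ← Multiset.coe_add, Multiset.coe_reverse,
      Multiset.add_cons, Multiset.cons_swap]
  have hle := h.le _ (fun y hy => h.bounds y (hperm.mem_iff.1 hy)) (hperm.sum_eq.trans h.sum_eq)
  have hD : ∀ y ∈ D, 1 ≤ y := fun y hy => (h.bounds y (by simp [hy])).1
  have hD' : contntTail D.reverse ≤ contnt D := by
    simpa using contntTail_le (l := D.reverse) (by simpa using hD)
  have key : contntTail D.reverse + b' * contnt D < b * contnt D + contntTail D := by
    rcases eq_or_ne D [] with rfl | hne
    · simpa using hb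
    · have := contntTail_pos hD hne
      nlinarith [Nat.mul_le_mul_right (contnt D) hb]
  have e1 := contnt_block X D C b b'
  have e2 := contnt_block X D.reverse C b' b
  have e3 : contnt (b' :: (D.reverse ++ [b])) = contnt (b :: (D ++ [b'])) := by
    rw [← contnt_reverse_s6]
    simp only [List.reverse_append, List.reverse_cons, List.reverse_reverse,
      List.reverse_nil, List.nil_append, List.cons_append]
  rw [e3, contnt_reverse_s6, List.reverse_reverse] at e2
  rw [e1, e2] at hle
  unfold CFGt at hR
  obtain ⟨k, hk⟩ := Nat.exists_eq_add_of_lt key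
  obtain ⟨r, hr⟩ := Nat.exists_eq_add_of_lt hR
  zify at *
  have hpos : (0 : ℤ) < (k + 1) * (r + 1) := by positivity
  have hk' : ((k : ℤ) + 1) = b * contnt D + contntTail D - (contntTail D.reverse + b' * contnt D) := by
    linarith
  have hr' : ((r : ℤ) + 1) = contnt X * contntTail C - contntTail X * contnt C := by linarith
  rw [hk', hr'] at hpos
  nlinarith

theorem not_cfGt_of_lt' {X D C : List ℕ} {b b' : ℕ}
    (h : IsMinSeq n S (X.reverse ++ b :: (D ++ b' :: C))) (hb : b < b') : ¬ CFGt C X := by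
  have := h.reverse
  simp only [List.reverse_append, List.reverse_cons, List.reverse_reverse, List.append_assoc,
    List.singleton_append] at this
  exact this.not_cfGt_of_lt hb

theorem one_le (h : IsMinSeq n S a) : ∀ y ∈ a, 1 ≤ y := fun y hy => (h.bounds y hy).1

/-- At most one entry of a minimiser lies strictly between `1` and `n`. -/
theorem not_two_middle {A D C : List ℕ} {b b' : ℕ} (h : IsMinSeq n S (A ++ b :: (D ++ b' :: C)))
    (hb : 1 < b) (hbn : b < n) (hb' : 1 < b') (hbn' : b' < n) : False := by
  obtain ⟨X, rfl⟩ : ∃ X : List ℕ, A = X.reverse := ⟨A.reverse, by simp⟩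
  have hpos := h.one_le
  simp only [List.mem_append, List.mem_cons, List.mem_reverse] at hpos
  have hX := contnt_pos (l := X) fun y hy => hpos y (by tauto)
  have hD := contnt_pos (l := D) fun y hy => hpos y (by tauto)
  have hC := contnt_pos (l := C) fun y hy => hpos y (by tauto)
  obtain ⟨b, rfl⟩ : ∃ c, b = c + 1 := ⟨b - 1, by omega⟩
  obtain ⟨b', rfl⟩ : ∃ c, b' = c + 1 := ⟨b' - 1, by omega⟩
  have hbd := h.bounds
  have hs := h.sum_eq
  simp only [List.forall_mem_append, List.forall_mem_cons] at hbd
  simp only [List.sum_append, List.sum_cons] at hs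
  have h1 := h.le (X.reverse ++ b :: (D ++ (b' + 2) :: C))
    (by simp only [List.forall_mem_append, List.forall_mem_cons]
        exact ⟨hbd.1, by omega, hbd.2.2.1, by omega, hbd.2.2.2.2⟩)
    (by simp only [List.sum_append, List.sum_cons]; omega)
  have h2 := h.le (X.reverse ++ (b + 2) :: (D ++ b' :: C))
    (by simp only [List.forall_mem_append, List.forall_mem_cons]
        exact ⟨hbd.1, by omega, hbd.2.2.1, by omega, hbd.2.2.2.2⟩)
    (by simp only [List.sum_append, List.sum_cons]; omega)
  have e : ∃ g, ∀ c, contntTail (D ++ c :: C) = c * (contntTail D * contnt C) + g := by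
    cases D with
    | nil => exact ⟨contnt C, by simp⟩
    | cons d D =>
      refine ⟨contnt D * contntTail C + contntTail D.reverse * contnt C, fun c => ?_⟩
      simp only [List.cons_append, contntTail_cons, contnt_append, contnt_cons]
      ring
  obtain ⟨g, hg⟩ := e
  simp only [contnt_reverse_append, contnt_cons, contntTail_cons, hg] at h1 h2
  simp only [contnt_append, contnt_cons, contntTail_cons] at h1 h2
  have := Nat.mul_pos (Nat.mul_pos hX hD) hC
  ring_nf at h1 h2 this
  linarith

/-- Merging a `1` into its left neighbour decreases the continuant, except at the very left. -/
theorem eq_of_merge {A C : List ℕ} {x y : ℕ} (h : IsMinSeq n S (A ++ x :: 1 :: y :: C))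
    (hx : x < n) : A = [] ∧ x = 1 := by
  obtain ⟨X, rfl⟩ : ∃ X : List ℕ, A = X.reverse := ⟨A.reverse, by simp⟩
  have hbd := h.bounds
  have hs := h.sum_eq
  simp only [List.forall_mem_append, List.forall_mem_cons, List.mem_reverse] at hbd
  simp only [List.sum_append, List.sum_cons] at hs
  have h1 := h.le (X.reverse ++ (x + 1) :: y :: C)
    (by simp only [List.forall_mem_append, List.forall_mem_cons, List.mem_reverse]
        exact ⟨hbd.1, by omega, hbd.2.2.2⟩)
    (by simp only [List.sum_append, List.sum_cons]; omega)
  simp only [contnt_reverse_append, contnt_cons, contntTail_cons] at h1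
  have hC := contnt_pos fun y hy => (hbd.2.2.2.2 y hy).1
  have hX := contnt_pos fun y hy => (hbd.1 y hy).1
  have hx1 := hbd.2.1.1
  have key : x * contnt X + contntTail X ≤ contnt X := by
    refine Nat.le_of_mul_le_mul_right ?_ hC
    nlinarith
  by_contra hcon
  rcases eq_or_ne X [] with rfl | hne
  · simp at key hcon
    omega
  · have := contntTail_pos (fun y hy => (hbd.1 y hy).1) hne
    nlinarith [Nat.mul_le_mul_right (contnt X) hx1]

theorem exists_head_eq_one (h : IsMinSeq n S a) (ha : a ≠ []) : ∃ l, IsMinSeq n S (1 :: l) ∧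
    (1 :: l = a ∨ ∃ c l', a = c :: l' ∧ 1 < c ∧ l = (c - 1) :: l') := by
  cases a with
  | nil => exact absurd rfl ha
  | cons c l =>
    have hbd := h.bounds
    have hs := h.sum_eq
    simp only [List.forall_mem_cons] at hbd
    rcases eq_or_lt_of_le hbd.1.1 with rfl | hc
    · exact ⟨l, h, Or.inl rfl⟩
    · refine ⟨(c - 1) :: l, h.of_contnt_eq ?_ ?_ ?_, Or.inr ⟨c, l, rfl, hc, rfl⟩⟩
      · simp only [List.forall_mem_cons]
        exact ⟨by omega, by omega, hbd.2⟩
      · simp only [List.sum_cons] at hs ⊢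
        omega
      · obtain ⟨c, rfl⟩ : ∃ d, c = d + 1 := ⟨c - 1, by omega⟩
        simp
        ring

/-- Some minimiser begins and ends with `1`. -/
theorem exists_one_ends (h : IsMinSeq n S a) (hS : 2 * n + 2 ≤ S) :
    ∃ M, IsMinSeq n S (1 :: (M ++ [1])) := by
  have hne : a ≠ [] := by rintro rfl; have := h.sum_eq; simp at this; omega
  obtain ⟨l, hl, -⟩ := h.exists_head_eq_one hne
  obtain ⟨l', hl', h'⟩ := hl.reverse.exists_head_eq_one (by simp)
  have hl2 := hl'.reverse
  rw [List.reverse_cons] at hl2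
  have hlne : l ≠ [] := by rintro rfl; have := hl.sum_eq; simp at this; omega
  have hlast : ∃ M, l'.reverse = 1 :: M := by
    rcases h' with h' | ⟨c, l'', hc, -, rfl⟩
    · have := congrArg List.reverse h'
      rw [List.reverse_reverse, List.reverse_cons] at this
      cases hr : l'.reverse with
      | nil => rw [hr] at this; simp at this; exact absurd this hlne
      | cons d M => rw [hr] at this; simp at this; exact ⟨M, by rw [this.1]⟩
    · have := congrArg List.reverse hc
      rw [List.reverse_reverse, List.reverse_cons] at this
      cases hr : l''.reverse with
      | nil => rw [hr] at this; simp at this; exact absurd this.2 hlne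
      | cons d M => rw [hr] at this; simp at this; exact ⟨M ++ [c - 1], by simp [hr, this.1]⟩
  obtain ⟨M, hM⟩ := hlast
  exact ⟨M, by simpa [hM] using hl2⟩

/-- In a minimiser with end entries `1`, the entry next to the last one is `n`. -/
theorem eq_of_penultimate {M : List ℕ} {f : ℕ} (h : IsMinSeq n S (1 :: (M ++ [f, 1])))
    (hS : 2 * n + 2 ≤ S) : f = n := by
  by_contra hfn
  have hbd := h.bounds
  have hs := h.sum_eq
  simp only [List.forall_mem_append, List.forall_mem_cons] at hbd
  simp only [List.sum_append, List.sum_cons, List.sum_nil] at hs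
  have hfn : f < n := by omega
  have h' : IsMinSeq n S (1 :: (M ++ [f + 1])) := by
    refine h.of_contnt_eq ?_ ?_ ?_
    · simp only [List.forall_mem_append, List.forall_mem_cons]
      exact ⟨by omega, hbd.2.1, by omega, by simp⟩
    · simp only [List.sum_append, List.sum_cons, List.sum_nil]
      omega
    · rw [← List.cons_append, ← List.cons_append, contnt_append, contnt_append]
      simp
  have hM : 1 ∉ M := by
    intro hmem
    obtain ⟨A, D, rfl⟩ := List.append_of_mem hmem
    have h2 : IsMinSeq n S ((A.reverse ++ [1]).reverse ++ 1 :: (D ++ (f + 1) :: [])) := by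
      simpa using h'
    refine h2.not_cfGt_of_lt' (by omega) ?_
    have : 0 < contntTail (A.reverse ++ [1]) := by
      refine contntTail_pos (fun y hy => ?_) (by simp)
      simp only [List.mem_append, List.mem_reverse, List.mem_singleton] at hy
      rcases hy with hy | rfl
      · exact (hbd.2.1 y (by simp [hy])).1
      · exact le_rfl
    simpa [CFGt] using this
  have hr : M = M.reverse.reverse := by simp
  rcases hMr : M.reverse with _ | ⟨y, _ | ⟨p, L⟩⟩
  · rw [hMr] at hr; subst hr; simp at hs; omega
  · rw [hMr] at hr; subst hr; simp at hs hbd; omega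
  · rw [hMr] at hr
    subst hr
    have hp : 1 < p := by
      have := (hbd.2.1 p (by simp)).1
      have : p ≠ 1 := by rintro rfl; exact hM (by simp)
      omega
    have hy : 1 < y := by
      have := (hbd.2.1 y (by simp)).1
      have : y ≠ 1 := by rintro rfl; exact hM (by simp)
      omega
    have hyn := (hbd.2.1 y (by simp)).2
    have hyf : f < y := by
      rcases eq_or_lt_of_le hyn with rfl | hyn
      · exact hfn
      · rcases eq_or_lt_of_le hbd.2.2.1.1 with rfl | hf
        · exact hy
        · refine (IsMinSeq.not_two_middle (S := S) (A := 1 :: (L.reverse ++ [p])) (D := []) (C := [1])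
            ?_ hy hyn hf hfn).elim
          simpa using h
    have h2 : IsMinSeq n S ((p :: (L ++ [1])).reverse ++ y :: ([] ++ f :: [1])) := by
      simpa using h
    refine h2.not_cfGt_of_lt hyf (CFGt.of_head ?_ (by simp) (by simp) hp)
    intro v hv
    simp only [List.mem_append, List.mem_singleton] at hv
    rcases hv with hv | rfl
    · exact (hbd.2.1 v (by simp [hv])).1
    · exact le_rfl

end IsMinSeq

/-- A minimiser of the form `1, n, …, n, 1`. -/
structure IsEndedMinSeq (n S : ℕ) (a : List ℕ) : Prop extends IsMinSeq n S a where
  head : ∃ L, a = 1 :: n :: L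
  last : ∃ L, a = L ++ [n, 1]

theorem exists_isEndedMinSeq {n S : ℕ} (hn : 1 ≤ n) (hS : 2 * n + 2 ≤ S) :
    ∃ a, IsEndedMinSeq n S a := by
  obtain ⟨a, ha⟩ := exists_isMinSeq hn S
  obtain ⟨M, hM⟩ := ha.exists_one_ends hS
  have hs := hM.sum_eq
  cases M with
  | nil => simp at hs; omega
  | cons g M =>
    have hr := hM.reverse
    simp only [List.reverse_cons, List.reverse_append, List.reverse_nil, List.nil_append,
      List.cons_append, List.append_assoc] at hr
    obtain rfl := hr.eq_of_penultimate hS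
    obtain ⟨M', f, hf⟩ : ∃ M' f, g :: M = M' ++ [f] :=
      ⟨_, _, (List.dropLast_append_getLast (List.cons_ne_nil g M)).symm⟩
    have hM' : IsMinSeq g S (1 :: (M' ++ [f, 1])) := by
      rw [hf] at hM
      simpa using hM
    obtain rfl := hM'.eq_of_penultimate hS
    exact ⟨_, hM', ⟨M ++ [1], by simpa using (congrArg (· ++ [1]) hf).symm⟩, ⟨1 :: M', by simp⟩⟩

namespace IsEndedMinSeq

variable {n S : ℕ} {a : List ℕ}

protected theorem reverse (h : IsEndedMinSeq n S a) : IsEndedMinSeq n S a.reverse := by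
  refine ⟨h.toIsMinSeq.reverse, ?_, ?_⟩
  · obtain ⟨L, rfl⟩ := h.last
    exact ⟨L.reverse, by simp⟩
  · obtain ⟨L, rfl⟩ := h.head
    exact ⟨L.reverse, by simp⟩

theorem eq_one_of_last (h : IsEndedMinSeq n S a) {A : List ℕ} {y : ℕ} (ha : a = A ++ [y]) :
    y = 1 := by
  obtain ⟨L, hL⟩ := h.last
  have : A ++ [y] = (L ++ [n]) ++ [1] := by rw [← ha, hL]; simp
  simpa using (List.append_inj' this rfl).2

theorem eq_of_before_one (h : IsEndedMinSeq n S a) (hn : 2 ≤ n) {A C : List ℕ} {x : ℕ}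
    (ha : a = A ++ x :: 1 :: C) : x = n := by
  cases C with
  | nil =>
    obtain ⟨L, hL⟩ := h.last
    have : A ++ [x, 1] = L ++ [n, 1] := by rw [← ha, hL]
    simpa using (List.append_inj' this rfl).2
  | cons y C =>
    by_contra hx
    have hx2 := (h.bounds x (by simp [ha])).2
    obtain ⟨L, hL⟩ := h.head
    obtain ⟨rfl, rfl⟩ := IsMinSeq.eq_of_merge (ha ▸ h.toIsMinSeq) (by omega)
    rw [ha] at hL
    simp at hL
    omega

theorem eq_of_after_one (h : IsEndedMinSeq n S a) (hn : 2 ≤ n) {A C : List ℕ} {y : ℕ}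
    (ha : a = A ++ 1 :: y :: C) : y = n :=
  h.reverse.eq_of_before_one hn (A := C.reverse) (C := A.reverse) (by simp [ha])

theorem not_block (h : IsEndedMinSeq n S a) {X D T : List ℕ} {b b' r : ℕ}
    (ha : a = (n :: 1 :: X).reverse ++ b :: (D ++ b' :: n :: r :: T)) (hb : b' < b)
    (hr : 2 ≤ r) : False := by
  refine IsMinSeq.not_cfGt_of_lt (ha ▸ h.toIsMinSeq) hb ?_
  rw [cfGt_cons_iff]
  have hp := h.one_le
  rw [ha] at hp
  refine CFGt.of_head (fun y hy => hp y (by simp [hy])) (fun y hy => hp y ?_) ?_ hr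
  · simp only [List.mem_append, List.mem_reverse, List.mem_cons]; tauto
  · rintro rfl
    have := h.eq_one_of_last (A := (n :: 1 :: X).reverse ++ b :: (D ++ [b', n])) (y := r)
      (by simp [ha])
    omega

/-- Behind an inner `1` preceded by a block that starts with `1, n` and an entry `≥ 2`, a minimiser
continues periodically. -/
theorem exists_eq_altList (h : IsEndedMinSeq n S a) (hn : 2 ≤ n) {X : List ℕ} {b : ℕ}
    (hb : 2 ≤ b) (D T : List ℕ) (ha : a = (n :: 1 :: X).reverse ++ b :: (D ++ 1 :: T)) :
    ∃ q, T = altList n 1 q := by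
  match T with
  | [] => exact ⟨0, rfl⟩
  | [t] =>
    have := h.eq_of_after_one hn (A := (n :: 1 :: X).reverse ++ b :: D) (y := t) (C := [])
      (by simp [ha])
    have := h.eq_one_of_last (A := (n :: 1 :: X).reverse ++ b :: (D ++ [1])) (y := t)
      (by simp [ha])
    omega
  | t :: r :: T =>
    have ht := (h.eq_of_after_one hn (A := (n :: 1 :: X).reverse ++ b :: D) (y := t)
      (C := r :: T) (by simp [ha])).symm
    subst ht
    rcases Nat.lt_or_ge r 2 with hr | hr
    · have := h.one_le r (by simp [ha])
      obtain rfl : r = 1 := by omega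
      obtain ⟨q, rfl⟩ := h.exists_eq_altList (X := X) hn hb (D ++ [1, n]) T (by simp [ha])
      exact ⟨q + 1, rfl⟩
    · exact (h.not_block ha (by omega) hr).elim
  termination_by T.length

end IsEndedMinSeq

theorem exists_altList_append (a b : ℕ) (L : List ℕ) :
    ∃ p R, L = altList a b p ++ R ∧ ∀ R', R ≠ a :: b :: R' := by
  by_cases hL : ∃ R', L = a :: b :: R'
  · obtain ⟨R', rfl⟩ := hL
    obtain ⟨p, R, hR, h⟩ := exists_altList_append a b R'
    exact ⟨p + 1, R, by rw [hR]; rfl, h⟩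
  · exact ⟨0, L, rfl, fun R' hR' => hL ⟨R', hR'⟩⟩
  termination_by L.length

theorem exists_replicate_append (n : ℕ) (L : List ℕ) (hL : ∃ y ∈ L, y ≠ n) :
    ∃ x z R, L = List.replicate x n ++ z :: R ∧ z ≠ n := by
  induction L with
  | nil => simp at hL
  | cons c L ih =>
    rcases eq_or_ne c n with rfl | hc
    · obtain ⟨x, z, R, rfl, hz⟩ := ih (by simpa using hL)
      exact ⟨x + 1, z, R, rfl, hz⟩
    · exact ⟨0, c, L, rfl, hc⟩

/-- The sequence `(1, n)^p, n^x, z, (n, 1)^q`. -/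
def shape (n p x z q : ℕ) : List ℕ :=
  altList 1 n p ++ (List.replicate x n ++ z :: altList n 1 q)

theorem replicate_append_cons_self (n j : ℕ) (l : List ℕ) :
    List.replicate j n ++ n :: l = n :: (List.replicate j n ++ l) := by
  rw [← List.cons_append, ← List.replicate_succ, List.replicate_succ']
  simp

theorem shape_reverse_one (n p x q : ℕ) :
    (shape n (p + 1) x 1 q).reverse = shape n (q + 1) x 1 p := by
  simp only [shape, List.reverse_append, List.reverse_cons, altList_reverse,
    List.reverse_replicate, List.append_assoc, List.singleton_append]
  rw [altList_succ' 1 n q, altList]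
  simp only [List.append_assoc, List.cons_append, List.nil_append, replicate_append_cons_self]

namespace IsEndedMinSeq

variable {n S : ℕ} {a : List ℕ}

theorem exists_shape (h : IsEndedMinSeq n S a) (hn : 2 ≤ n) :
    ∃ p x z q, 1 ≤ p ∧ 1 ≤ z ∧ z < n ∧ (z ≠ 1 → 1 ≤ q) ∧
      (a = shape n p x z q ∨ a.reverse = shape n p x z q) := by
  obtain ⟨p, R, haR, hR⟩ := exists_altList_append 1 n a
  have hp : 1 ≤ p := by
    by_contra hp
    obtain rfl : p = 0 := by omega
    obtain ⟨L, hL⟩ := h.head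
    exact hR L (by rw [← hL, haR]; rfl)
  obtain ⟨X, hX⟩ : ∃ X, altList 1 n p = (n :: 1 :: X).reverse := by
    obtain ⟨p, rfl⟩ : ∃ p', p = p' + 1 := ⟨p - 1, by omega⟩
    exact ⟨altList n 1 p, by simp [altList_succ']⟩
  have hex : ∃ y ∈ R, y ≠ n := by
    by_contra hcon
    push Not at hcon
    rcases List.eq_nil_or_concat R with rfl | ⟨R', y, rfl⟩
    · have := h.eq_one_of_last (A := (1 :: X).reverse) (y := n) (by rw [haR, hX]; simp)
      omega
    · have := h.eq_one_of_last (A := altList 1 n p ++ R') (y := y) (by rw [haR]; simp)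
      have := hcon y (by simp)
      omega
  obtain ⟨x, z, R', rfl, hz⟩ := exists_replicate_append n R hex
  have hzb := h.bounds z (by simp [haR])
  have hzn : z < n := by omega
  rcases Nat.lt_or_ge z 2 with hz1 | hz2
  · obtain rfl : z = 1 := by omega
    obtain ⟨q, rfl⟩ : ∃ q, R' = altList n 1 q := by
      cases x with
      | zero =>
        cases R' with
        | nil => exact ⟨0, rfl⟩
        | cons r R' =>
          obtain rfl := h.eq_of_after_one hn (A := altList 1 n p) (y := r) (C := R') (by simp [haR])
          exact (hR R' rfl).elim
      | succ x =>
        exact h.exists_eq_altList (X := X) hn hn (List.replicate x n) R' (by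
          rw [haR, hX, List.replicate_succ]; simp)
    exact ⟨p, x, 1, q, hp, le_rfl, hzn, by simp, Or.inl haR⟩
  · have hmid : ∀ {A D C : List ℕ} {b : ℕ}, a = A ++ z :: (D ++ b :: C) → 1 < b → b = n := by
      intro A D C b hab hb
      by_contra hbn
      have := (h.bounds b (by simp [hab])).2
      exact IsMinSeq.not_two_middle (hab ▸ h.toIsMinSeq) hz2 hzn hb (by omega)
    match R' with
    | [] =>
      have := h.eq_one_of_last (A := altList 1 n p ++ List.replicate x n) (y := z) (by simp [haR])
      omega
    | [r] =>
      obtain rfl := h.eq_one_of_last (A := altList 1 n p ++ (List.replicate x n ++ [z])) (y := r)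
        (by simp [haR])
      have := h.eq_of_before_one hn (A := altList 1 n p ++ List.replicate x n) (x := z) (C := [])
        (by simp [haR])
      omega
    | r :: s :: T =>
      have hr : r ≠ 1 := by
        rintro rfl
        have := h.eq_of_before_one hn (A := altList 1 n p ++ List.replicate x n) (x := z)
          (C := s :: T) (by simp [haR])
        omega
      have := h.one_le r (by simp [haR])
      obtain rfl := hmid (A := altList 1 n p ++ List.replicate x n) (D := []) (C := s :: T)
        (by simp [haR]) (show 1 < r by omega)
      have hs1 := h.one_le s (by simp [haR])
      rcases Nat.lt_or_ge s 2 with hs | hs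
      · obtain rfl : s = 1 := by omega
        obtain ⟨q, rfl⟩ : ∃ q, T = altList r 1 q := by
          cases x with
          | zero => exact h.exists_eq_altList (X := X) hn hz2 [r] T (by rw [haR, hX]; simp)
          | succ x =>
            exact h.exists_eq_altList (X := X) hn hn (List.replicate x r ++ [z, r]) T
              (by rw [haR, hX, List.replicate_succ]; simp)
        exact ⟨p, x, z, q + 1, hp, by omega, hzn, by omega, Or.inl haR⟩
      · cases x with
        | succ x =>
          exact (h.not_block (X := X) (b := r) (b' := z) (D := List.replicate x r) (r := s) (T := T)
            (by rw [haR, hX, List.replicate_succ]; simp) hzn hs).elim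
        | zero =>
          obtain rfl := hmid (A := altList 1 r p) (D := [r]) (C := T) (by simp [haR]) hs
          have hex : ∃ y ∈ T, y ≠ s := by
            by_contra hcon
            push Not at hcon
            rcases List.eq_nil_or_concat T with rfl | ⟨T', y, rfl⟩
            · have := h.eq_one_of_last (A := altList 1 s p ++ [z, s]) (y := s) (by simp [haR])
              omega
            · have := h.eq_one_of_last (A := altList 1 s p ++ z :: s :: s :: T') (y := y)
                (by simp [haR])
              have := hcon y (by simp)
              omega
          obtain ⟨j, w, T', rfl, hw⟩ := exists_replicate_append s T hex
          have hw1 := h.one_le w (by simp [haR])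
          obtain rfl : w = 1 := by
            by_contra hw2
            exact hw (hmid (A := altList 1 s p) (D := s :: s :: List.replicate j s) (C := T')
              (by simp [haR]) (by omega))
          obtain ⟨q, rfl⟩ := h.exists_eq_altList (X := X) hn hz2 (s :: s :: List.replicate j s) T'
            (by rw [haR, hX]; simp)
          refine ⟨q + 1, j + 1, z, p, by omega, by omega, hzn, fun _ => hp, Or.inr ?_⟩
          simp [haR, shape, altList_succ', List.replicate_succ, replicate_append_cons_self]

end IsEndedMinSeq

namespace IsMinSeq

variable {n S p x z q : ℕ}

theorem shape_le_add_one (h : IsMinSeq n S (shape n p x z q)) (hn : 2 ≤ n) (hz : 1 < z) :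
    p ≤ q + 1 := by
  by_contra hpq
  obtain ⟨p, rfl⟩ : ∃ p', p = p' + 1 := ⟨p - 1, by omega⟩
  have h' : IsMinSeq n S ((altList n 1 p).reverse ++
      1 :: ((n :: List.replicate x n) ++ z :: altList n 1 q)) := by
    simpa [shape, altList_succ'] using h
  exact h'.not_cfGt_of_lt' hz (cfGt_altList (by omega) (by omega))

theorem shape_le (h : IsMinSeq n S (shape n p (x + 1) z q)) (hn : 2 ≤ n) (hz : z < n) :
    q ≤ p := by
  by_contra hpq
  have h' : IsMinSeq n S ((altList n 1 p).reverse ++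
      n :: (List.replicate x n ++ z :: altList n 1 q)) := by
    simpa [shape, List.replicate_succ] using h
  exact h'.not_cfGt_of_lt hz (cfGt_altList (by omega) (by omega))

theorem shape_one_le (h : IsMinSeq n S (shape n p (x + 1) 1 q)) (hn : 2 ≤ n) :
    p ≤ q + 2 := by
  by_contra hpq
  obtain ⟨p, rfl⟩ : ∃ p', p = p' + 1 := ⟨p - 1, by omega⟩
  have h' : IsMinSeq n S ((altList n 1 p).reverse ++
      1 :: (List.replicate x n ++ n :: altList n 1 (q + 1))) := by
    rw [shape, altList_succ'] at h
    simpa [altList, List.replicate_succ, replicate_append_cons_self] using h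
  exact h'.not_cfGt_of_lt' (by omega) (cfGt_altList (j := q + 1) (by omega) (by omega))

end IsMinSeq

theorem shape_zero_one (n p q : ℕ) : shape n p 0 1 q = altList 1 n (p + q) ++ [1] := by
  simp [shape, altList_add, cons_altList]

theorem shape_zero_reverse (n p z q : ℕ) : (shape n p 0 z q).reverse = shape n q 0 z p := by
  simp [shape]

/-- Some minimiser has the form `(1, n)^p, n^x, z, (n, 1)^q` with `p ∈ {q, q + 1}`. -/
theorem exists_isMinSeq_shape {n S : ℕ} (hn : 2 ≤ n) (hS : 2 * n + 2 ≤ S) :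
    ∃ p x z q, IsMinSeq n S (shape n p x z q) ∧ 1 ≤ p ∧ 1 ≤ z ∧ z < n ∧ (p = q ∨ p = q + 1) := by
  obtain ⟨a, ha⟩ := exists_isEndedMinSeq (by omega) hS
  obtain ⟨p, x, z, q, hp, hz, hzn, hq, h⟩ := ha.exists_shape hn
  have hm : IsMinSeq n S (shape n p x z q) := by
    rcases h with h | h
    · exact h ▸ ha.toIsMinSeq
    · exact h ▸ ha.toIsMinSeq.reverse
  rcases eq_or_lt_of_le hz with rfl | hz1
  · cases x with
    | zero =>
      refine ⟨p + q - (p + q) / 2, 0, 1, (p + q) / 2, ?_, by omega, le_rfl, hzn, by omega⟩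
      rw [shape_zero_one] at hm ⊢
      rwa [show p + q - (p + q) / 2 + (p + q) / 2 = p + q by omega]
    | succ x =>
      obtain ⟨p, rfl⟩ : ∃ p', p = p' + 1 := ⟨p - 1, by omega⟩
      have h1 := hm.shape_one_le hn
      have h2 := hm.shape_le hn hzn
      by_cases hpq : p = q + 1
      · have hm' := hm.reverse
        rw [shape_reverse_one] at hm'
        exact ⟨_, _, _, _, hm', by omega, le_rfl, hzn, by omega⟩
      · exact ⟨_, _, _, _, hm, by omega, le_rfl, hzn, by omega⟩
  · have hq := hq (by omega)
    have h1 := hm.shape_le_add_one hn hz1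
    cases x with
    | zero =>
      have hm' := hm.reverse
      rw [shape_zero_reverse] at hm'
      have h2 := hm'.shape_le_add_one hn hz1
      by_cases hpq : p < q
      · exact ⟨_, _, _, _, hm', hq, hz, hzn, by omega⟩
      · exact ⟨_, _, _, _, hm, hp, hz, hzn, by omega⟩
    | succ x =>
      have h2 := hm.shape_le hn hzn
      exact ⟨_, _, _, _, hm, hp, hz, hzn, by omega⟩

theorem contnt_replicate_append_ge (n : ℕ) (X : List ℕ) (k : ℕ) :
    n ^ k * contnt X ≤ contnt (List.replicate k n ++ X) := by
  induction k with
  | zero => simp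
  | succ k ih =>
    rw [List.replicate_succ, List.cons_append, contnt_cons, pow_succ]
    nlinarith [Nat.mul_le_mul_left n ih]

theorem contnt_altList_append_le {n : ℕ} {X : List ℕ} (hX : n * contntTail X ≤ contnt X) (k : ℕ) :
    n * contntTail (altList n 1 k ++ X) ≤ contnt (altList n 1 k ++ X) ∧
      contnt (altList n 1 k ++ X) ≤ (n + 2) ^ k * contnt X := by
  induction k with
  | zero => simpa [altList] using hX
  | succ k ih =>
    simp only [altList, List.cons_append, contnt_cons, contntTail_cons, pow_succ]
    constructor
    · omega
    · nlinarith [ih.1, ih.2]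

theorem add_two_pow_lt {n : ℕ} (hn : 8 ≤ n) : (n + 2) ^ n < n ^ (n + 1) := by
  have hn0 : (0 : ℝ) < n := by exact_mod_cast (by omega : 0 < n)
  have h1 : (1 + 2 / (n : ℝ)) ^ n ≤ Real.exp 2 := by
    calc (1 + 2 / (n : ℝ)) ^ n ≤ Real.exp (2 / n) ^ n := by
          gcongr
          rw [add_comm]
          exact Real.add_one_le_exp _
      _ = Real.exp 2 := by
          rw [← Real.exp_nat_mul]
          congr 1
          field_simp
  have h2 : Real.exp 2 < 8 := by
    have := Real.exp_one_lt_d9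
    rw [show (2 : ℝ) = 1 + 1 by norm_num, Real.exp_add]
    nlinarith [Real.exp_pos 1]
  have h3 : ((n : ℝ) + 2) ^ n = (1 + 2 / (n : ℝ)) ^ n * n ^ n := by
    rw [← mul_pow]
    congr 1
    field_simp
  have h4 : ((n : ℝ) + 2) ^ n < n ^ (n + 1) := by
    rw [h3, pow_succ, mul_comm]
    have : (8 : ℝ) ≤ n := by exact_mod_cast hn
    gcongr
    linarith
  exact_mod_cast h4

/-- Trading `n + 1` copies of `n` for `n` copies of `1, n` decreases the continuant. -/
theorem contnt_altList_lt_replicate {n : ℕ} (hn : 2 ≤ n) {X C : List ℕ} (hX : 0 < contnt X)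
    (hC : 0 < contnt C) (h1 : (2 * n + 1) * contntTail X ≤ 2 * contnt X)
    (h2 : 8 * contntTail X ≤ 3 * contnt X ∨ n ≠ 2)
    (h3 : contnt C ≤ (n + 1) * contntTail C) :
    contnt ((altList n 1 n ++ X).reverse ++ C) <
      contnt ((List.replicate (n + 1) n ++ X).reverse ++ C) := by
  rw [contnt_reverse_append, contnt_reverse_append]
  have hnX : n * contntTail X ≤ contnt X := by nlinarith
  have hPQ := Nat.mul_pos hX hC
  have hR1 := Nat.mul_le_mul_right (contnt C) hnX
  have hT1 := Nat.mul_le_mul_right (contntTail C) hnX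
  have hQ1 := Nat.mul_le_mul_left (contnt X) h3
  rcases Nat.lt_or_ge n 8 with hn8 | hn8
  · interval_cases n
    · have h2 : 8 * contntTail X ≤ 3 * contnt X := by simpa using h2
      have hR := Nat.mul_le_mul_right (contnt C) h2
      have hT := Nat.mul_le_mul_right (contntTail C) h2
      simp only [altList, List.replicate, List.cons_append, List.nil_append, contnt_cons,
        contntTail_cons]
      linarith
    all_goals
      simp only [altList, List.replicate, List.cons_append, List.nil_append, contnt_cons,
        contntTail_cons]
      linarith
  · obtain ⟨ha, hb⟩ := contnt_altList_append_le hnX n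
    have hc := contnt_replicate_append_ge n X (n + 1)
    have hd := contnt_replicate_append_ge n X n
    have hp := add_two_pow_lt hn8
    have he : contntTail (List.replicate (n + 1) n ++ X) = contnt (List.replicate n n ++ X) := rfl
    have hp' := Nat.mul_lt_mul_of_pos_right hp hX
    have hA : contnt (altList n 1 n ++ X) < contnt (List.replicate (n + 1) n ++ X) := by omega
    have hB : contntTail (altList n 1 n ++ X) ≤ contntTail (List.replicate (n + 1) n ++ X) := by
      rw [he]
      refine Nat.le_of_mul_le_mul_left ?_ (show 0 < n by omega)
      rw [pow_succ] at hp'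
      nlinarith [Nat.mul_le_mul_left n hd]
    have := Nat.mul_lt_mul_of_pos_right hA hC
    have := Nat.mul_le_mul_right (contntTail C) hB
    omega

theorem IsMinSeq.shape_x_le {n S p x z q : ℕ} (h : IsMinSeq n S (shape n p x z q)) (hn : 2 ≤ n)
    (hp : 1 ≤ p) : x ≤ n := by
  by_contra hx
  obtain ⟨y, rfl⟩ : ∃ y, x = n + 1 + y := ⟨x - (n + 1), by omega⟩
  obtain ⟨C, hC⟩ : ∃ C, C = List.replicate y n ++ z :: altList n 1 q := ⟨_, rfl⟩
  obtain ⟨X, hX⟩ : ∃ X, X = altList n 1 p := ⟨_, rfl⟩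
  have e1 : shape n p (n + 1 + y) z q = (List.replicate (n + 1) n ++ X).reverse ++ C := by
    rw [hX, hC, shape, List.replicate_add]
    simp only [List.reverse_append, altList_reverse, List.reverse_replicate, List.append_assoc]
  rw [e1] at h
  have hbd := h.bounds
  have hs := h.sum_eq
  simp only [List.forall_mem_append, List.mem_reverse] at hbd
  simp only [List.sum_append, List.sum_reverse, List.sum_replicate, smul_eq_mul] at hs
  have hle := h.le ((altList n 1 n ++ X).reverse ++ C)
    (by
      simp only [List.forall_mem_append, List.mem_reverse]
      exact ⟨⟨forall_mem_altList (by omega) (by omega) _, hbd.1.2⟩, hbd.2⟩)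
    (by
      simp only [List.sum_append, List.sum_reverse, sum_altList]
      rw [← hs]
      ring)
  have hCne : ∃ c C', C = c :: C' := by
    cases y
    · exact ⟨_, _, by rw [hC]; rfl⟩
    · exact ⟨_, _, by rw [hC]; rfl⟩
  obtain ⟨c, C', rfl⟩ := hCne
  have hC' : ∀ v ∈ C', 1 ≤ v := fun v hv => (hbd.2 v (by simp [hv])).1
  obtain ⟨p, rfl⟩ : ∃ p', p = p' + 1 := ⟨p - 1, by omega⟩
  have hY : ∀ v ∈ altList n 1 p, 1 ≤ v := forall_mem_altList (by omega) (by omega) _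
  have hY1 : n * contntTail (altList n 1 p) ≤ contnt (altList n 1 p) := by
    have := (contnt_altList_append_le (n := n) (X := []) (by simp) p).1
    simpa using this
  refine absurd hle (not_le.2 (contnt_altList_lt_replicate hn ?_ ?_ ?_ ?_ ?_))
  · exact contnt_pos fun v hv => (hbd.1.2 v hv).1
  · exact contnt_pos fun v hv => (hbd.2 v hv).1
  · have := contntTail_le hY
    rw [hX]
    simp only [altList, contnt_cons, contntTail_cons]
    nlinarith
  · rcases eq_or_ne n 2 with rfl | h2
    · left
      rw [hX]
      simp only [altList, contnt_cons, contntTail_cons]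
      omega
    · exact Or.inr h2
  · have := contntTail_le hC'
    have := Nat.mul_le_mul_right (contnt C') (hbd.2 c (by simp)).2
    simp only [contnt_cons, contntTail_cons]
    nlinarith

theorem map_range_eq_altList (a b k : ℕ) :
    (List.range (2 * k)).map (fun i => if i % 2 = 0 then a else b) = altList a b k := by
  induction k with
  | zero => rfl
  | succ k ih =>
    rw [show 2 * (k + 1) = 2 * k + 1 + 1 by ring, List.range_succ, List.range_succ,
      altList_succ', ← ih]
    simp [Nat.add_mod]

theorem tzSeq_eq_shape (n z m x : ℕ) :
    TzSeq n z m x = shape n (m - m / 2) x z (m / 2) := by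
  simp [TzSeq, Nseq, shape, map_range_eq_altList]

theorem sum_shape (n p x z q : ℕ) : (shape n p x z q).sum = z + n * x + (n + 1) * (p + q) := by
  simp only [shape, List.sum_append, List.sum_cons, sum_altList, List.sum_replicate, smul_eq_mul]
  ring

theorem forall_mem_shape {n p x z q : ℕ} (hn : 1 ≤ n) (hz : 1 ≤ z) (hzn : z ≤ n) :
    ∀ y ∈ shape n p x z q, 1 ≤ y ∧ y ≤ n := by
  simp only [shape, List.forall_mem_append, List.forall_mem_cons]
  refine ⟨forall_mem_altList (by omega) (by omega) _, ?_, ⟨hz, hzn⟩,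
    forall_mem_altList (by omega) (by omega) _⟩
  intro y hy
  rw [List.eq_of_mem_replicate hy]
  omega

theorem xz_mz_spec {n S z : ℕ} (h : 1 ≤ mz n S z) :
    ∃ x m : ℕ, xz n S z = x ∧ mz n S z = m ∧ x ≤ n ∧ 1 ≤ m ∧ S = z + n * x + (n + 1) * m := by
  have hn : (0 : ℤ) < (n : ℤ) + 1 := by positivity
  obtain ⟨x, hx⟩ := Int.eq_ofNat_of_zero_le (Int.emod_nonneg ((z : ℤ) - S) hn.ne')
  obtain ⟨m, hm⟩ := Int.eq_ofNat_of_zero_le (by omega : 0 ≤ mz n S z)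
  have hxn := Int.emod_lt_of_pos ((z : ℤ) - S) hn
  have hdiv : ((n : ℤ) + 1) ∣ (S : ℤ) - z - n * xz n S z := by
    have := Int.mul_ediv_add_emod ((z : ℤ) - S) (n + 1)
    refine ⟨-(((z : ℤ) - S) / (n + 1)) - xz n S z, ?_⟩
    unfold xz
    linarith
  have hmul := Int.mul_ediv_cancel' hdiv
  have hx' : xz n S z = x := hx
  refine ⟨x, m, hx', hm, by omega, by omega, ?_⟩
  rw [show ((S : ℤ) - z - n * xz n S z) / ((n : ℤ) + 1) = m from hm, hx'] at hmul
  zify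
  linarith

theorem xz_eq {n z x m : ℕ} (hx : x ≤ n) : xz n (z + n * x + (n + 1) * m) z = x := by
  have : (z : ℤ) - ((z + n * x + (n + 1) * m : ℕ) : ℤ) = x + (n + 1) * (-x - m) := by
    push_cast
    ring
  rw [xz, this, Int.add_mul_emod_self_left]
  exact Int.emod_eq_of_lt (by omega) (by omega)

theorem mz_eq {n z x m : ℕ} (hx : x ≤ n) : mz n (z + n * x + (n + 1) * m) z = m := by
  rw [mz, xz_eq hx]
  have : ((z + n * x + (n + 1) * m : ℕ) : ℤ) - z - n * x = (n + 1) * m := by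
    push_cast
    ring
  rw [this]
  exact Int.mul_ediv_cancel_left _ (by omega)

theorem mem_Icc_of_mem_Pset {n S z : ℕ} (hn : 2 ≤ n) (h : z ∈ Pset n S) : 1 ≤ z ∧ z < n := by
  have h1 : Sone n S < n := Nat.mod_lt _ (by omega)
  have h2 : 1 ≤ Szero n S := by unfold Szero; omega
  unfold Pset at h
  split_ifs at h <;> simp only [Finset.mem_union, Finset.mem_Icc] at h <;> omega

theorem mem_Pset {n z x m : ℕ} (hz : 1 ≤ z) (hzn : z < n) (hx : x ≤ n) (hm : 1 ≤ m) :
    z ∈ Pset n (z + n * x + (n + 1) * m) := by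
  by_cases hS : n ^ 2 - 1 ≤ z + n * x + (n + 1) * m
  · rw [Pset, if_pos hS, Finset.mem_Icc]
    omega
  have hS' : z + n * x + (n + 1) * m + 1 < n ^ 2 := by omega
  have hmn : x + m < n := by nlinarith
  have hS1 : Sone n (z + n * x + (n + 1) * m) = if z + m < n then z + m else z + m - n := by
    have e : z + n * x + (n + 1) * m = (z + m) + n * (x + m) := by ring
    rw [Sone, e, Nat.add_mul_mod_self_left]
    split_ifs with h
    · exact Nat.mod_eq_of_lt h
    · rw [Nat.mod_eq_sub_mod (by omega), Nat.mod_eq_of_lt (by omega)]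
  have hS0 : Szero n (z + n * x + (n + 1) * m) = if x < z then z - x else z + n + 1 - x := by
    rw [Szero]
    split_ifs with h
    · obtain ⟨k, rfl⟩ := Nat.exists_eq_add_of_lt h
      have e : x + k + 1 + n * x + (n + 1) * m - 1 = k + (n + 1) * (x + m) := by
        rw [show x + k + 1 + n * x + (n + 1) * m = k + (n + 1) * (x + m) + 1 by ring]
        rfl
      rw [e, Nat.add_mul_mod_self_left, Nat.mod_eq_of_lt (by omega)]
      omega
    · obtain ⟨m, rfl⟩ : ∃ m', m = m' + 1 := ⟨m - 1, by omega⟩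
      obtain ⟨k, hk⟩ : ∃ k, z + n = k + x := ⟨z + n - x, by omega⟩
      have e : z + n * x + (n + 1) * (m + 1) - 1 = k + (n + 1) * (x + m) := by
        have : z + n * x + (n + 1) * (m + 1) = k + (n + 1) * (x + m) + 1 := by
          linear_combination hk
        omega
      rw [e, Nat.add_mul_mod_self_left, Nat.mod_eq_of_lt (by omega)]
      omega
  rw [Pset, if_neg hS, hS1, hS0]
  split_ifs <;> simp only [Finset.mem_union, Finset.mem_Icc] <;> omega

/-- Theorem 7: for `n ≥ 2`, `S ≥ 2n+2`, the minimum of the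
continuant over `U_n(S)` equals the minimum over `z ∈ P*(S)` of `T_z(m(z),x(z))`. -/
theorem stmt_6 (n S : ℕ) (hn : 2 ≤ n) (hS : 2 * n + 2 ≤ S) :
    sInf {v : ℕ | ∃ a : List ℕ, (∀ y ∈ a, 1 ≤ y ∧ y ≤ n) ∧ a.sum = S ∧ contnt a = v} =
    sInf {v : ℕ | ∃ z ∈ Pstar n S, contnt (TzSeq n z (mz n S z).toNat (xz n S z)) = v} := by
  set A := {v : ℕ | ∃ a : List ℕ, (∀ y ∈ a, 1 ≤ y ∧ y ≤ n) ∧ a.sum = S ∧ contnt a = v}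
  set B := {v : ℕ | ∃ z ∈ Pstar n S, contnt (TzSeq n z (mz n S z).toNat (xz n S z)) = v}
  have hBA : B ⊆ A := by
    rintro v ⟨z, hz, rfl⟩
    rw [Pstar, Finset.mem_filter] at hz
    obtain ⟨hz1, hzn⟩ := mem_Icc_of_mem_Pset hn hz.1
    obtain ⟨x, m, hx, hm, -, -, hS'⟩ := xz_mz_spec hz.2
    rw [hx, hm, Int.toNat_natCast, tzSeq_eq_shape]
    refine ⟨_, forall_mem_shape (by omega) hz1 hzn.le, ?_, rfl⟩
    rw [sum_shape, hS']
    congr 2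
    omega
  obtain ⟨p, x, z, q, hmin, hp, hz, hzn, hpq⟩ := exists_isMinSeq_shape hn hS
  have hxn := hmin.shape_x_le hn hp
  have hmem : contnt (shape n p x z q) ∈ B := by
    have hsum := hmin.sum_eq
    rw [sum_shape] at hsum
    subst hsum
    refine ⟨z, ?_, ?_⟩
    · rw [Pstar, Finset.mem_filter, mz_eq hxn]
      exact ⟨mem_Pset hz hzn hxn (by omega), by omega⟩
    · rw [mz_eq hxn, xz_eq hxn, Int.toNat_natCast, tzSeq_eq_shape]
      rw [show p + q - (p + q) / 2 = p by omega, show (p + q) / 2 = q by omega]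
  refine le_antisymm ?_ ?_
  · exact Nat.sInf_le (hBA (Nat.sInf_mem ⟨_, hmem⟩))
  · obtain ⟨a, ha, hs, hv⟩ := Nat.sInf_mem ⟨_, hBA hmem⟩
    rw [← hv]
    exact (Nat.sInf_le hmem).trans (hmin.le a ha hs)
end

section
/- Let n, S be integers with 2 ≤ n ≤ S − 2, and let μ_n = (n + 2 + √(n² + 4n))/2. Then for every sequence (a_1,…,a_t) in U_n(S), the continuant satisfies ⟨a_1,…,a_t⟩ ≥ μ_n^{(S−n+1)/(n+1)} / e². -/
/-- Chord bound for the convex function `k ↦ x ^ k`. -/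
theorem mul_pow_sub_one_le_mul_pow_sub_one {x : ℝ} (hx : 1 ≤ x) {k m : ℕ} (hkm : k ≤ m) :
    (m : ℝ) * (x ^ k - 1) ≤ k * (x ^ m - 1) := by
  induction m, hkm using Nat.le_induction with
  | base => exact le_rfl
  | succ m hkm ih =>
    have key : ∀ j ≤ m, x ^ j - 1 ≤ j * (x ^ m * (x - 1)) := by
      intro j
      induction j with
      | zero => simp
      | succ j ihj =>
        intro hj
        have h1 := ihj (by omega)
        have h2 : x ^ j * (x - 1) ≤ x ^ m * (x - 1) :=
          mul_le_mul_of_nonneg_right (pow_le_pow_right₀ hx (by omega)) (by linarith)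
        rw [pow_succ]
        push_cast
        linarith
    have h := key k hkm
    rw [pow_succ x m]
    push_cast
    linarith

/-- If `x` exceeds the golden ratio then `x ^ (n + 1)` exceeds `n + 2` for `n ≥ 2`. -/
theorem add_two_le_pow_succ {x : ℝ} (hx : 1 ≤ x) (hx2 : 1 + x < x ^ 2) {n : ℕ} (hn : 2 ≤ n) :
    (n : ℝ) + 2 ≤ x ^ (n + 1) := by
  have h16 : 1.6 < x := by nlinarith
  induction n, hn using Nat.le_induction with
  | base => norm_num; nlinarith
  | succ n hn ih =>
    rw [pow_succ]
    have : (2 : ℝ) ≤ n := by exact_mod_cast hn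
    push_cast
    nlinarith

theorem one_add_two_div_pow_lt (m : ℕ) (hm : 0 < m) : (1 + 2 / (m : ℝ)) ^ m < 7.39 := by
  have hm' : (0 : ℝ) < m := by exact_mod_cast hm
  have h1 : (1 + 2 / (m : ℝ)) ^ m ≤ Real.exp (2 / m) ^ m :=
    pow_le_pow_left₀ (by positivity) (by linarith [Real.add_one_le_exp (2 / (m : ℝ))]) m
  have h2 : Real.exp (2 / m) ^ m = Real.exp 1 ^ 2 := by
    rw [← Real.exp_nat_mul, ← Real.exp_nat_mul]
    congr 1
    field_simp
    norm_num
  have := Real.exp_one_lt_d9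
  have := Real.exp_pos 1
  rw [h2] at h1
  nlinarith

/-- Lower bound for the `(n + 1)`-st root `x` of the larger root `μ` of
`μ ^ 2 - (n + 2) μ + 1`. -/
theorem sq_le_sq_add_mul {n : ℕ} (hn : 2 ≤ n) {μ x : ℝ} (hμ : (n : ℝ) + 1 < μ)
    (hμ' : μ < n + 2) (hq : μ ^ 2 - (n + 2) * μ + 1 = 0) (hx : 0 ≤ x)
    (hxμ : x ^ (n + 1) = μ) : μ ^ 2 ≤ x ^ 2 + (μ - 1) ^ 2 * x := by
  have mono : ∀ r : ℝ, 0 ≤ r → r ^ (n + 1) ≤ μ → μ ^ 2 ≤ r ^ 2 + (μ - 1) ^ 2 * r →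
      μ ^ 2 ≤ x ^ 2 + (μ - 1) ^ 2 * x := by
    intro r hr hrμ h
    have hrx : r ≤ x := by
      rw [← hxμ] at hrμ
      exact le_of_pow_le_pow_left₀ (by omega) hx hrμ
    have h1 : r ^ 2 ≤ x ^ 2 := pow_le_pow_left₀ hr hrx 2
    have h2 : (μ - 1) ^ 2 * r ≤ (μ - 1) ^ 2 * x := mul_le_mul_of_nonneg_left hrx (sq_nonneg _)
    linarith
  have hn' : (2 : ℝ) ≤ n := by exact_mod_cast hn
  have large : (1 + 2 / ((n + 1 : ℕ) : ℝ)) ^ (n + 1) ≤ μ →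
      μ ^ 2 ≤ x ^ 2 + (μ - 1) ^ 2 * x := by
    intro h
    refine mono _ (by positivity) h ?_
    push_cast
    have h0 : (0 : ℝ) < n + 1 := by positivity
    set d : ℝ := 2 / ((n : ℝ) + 1) with hd
    have hd0 : 0 < d := by positivity
    have hd1 : d * (n + 1) = 2 := by rw [hd]; field_simp
    have h3 : (μ - 1) ^ 2 = n * μ := by linarith
    rw [h3]
    have h4 : d * μ < d * (n + 2) := mul_lt_mul_of_pos_left hμ' hd0
    have h5 : d * (n * μ) = 2 * μ - d * μ := by linear_combination μ * hd1
    nlinarith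
  rcases Nat.lt_or_ge n 6 with h6 | h6
  · interval_cases n
    · norm_num at *
      have h1 : 3.732 < μ := by nlinarith
      have h2 : μ < 3.7321 := by nlinarith
      refine mono 1.547 (by norm_num) (by norm_num; linarith) (by nlinarith)
    · norm_num at *
      have h1 : 4.79 < μ := by nlinarith
      have h2 : μ < 4.8 := by nlinarith
      refine mono 1.47 (by norm_num) (by norm_num; linarith) (by nlinarith)
    · norm_num at *
      have h1 : 5.8 < μ := by nlinarith
      exact large (by linarith)
    · norm_num at *
      exact large (by linarith)
  · apply large
    have h7 : (6 : ℝ) ≤ n := by exact_mod_cast h6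
    have := one_add_two_div_pow_lt (n + 1) (by omega)
    have : 7.39 < μ := by nlinarith
    linarith

/-- The pair of linear functionals `(μ - 1) q + p` and `μ q + (μ - 1) p`, suitably weighted,
grows at least by the factor `x ^ a` under `(q, p) ↦ (a q + p, q)`. -/
theorem continuant_step {n a : ℕ} (hn : 2 ≤ n) (ha1 : 1 ≤ a) (han : a ≤ n) {μ x q p J : ℝ}
    (hμ : (n : ℝ) + 1 < μ) (hq : μ ^ 2 - (n + 2) * μ + 1 = 0) (hx : 1 ≤ x)
    (hxμ : x ^ (n + 1) = μ) (hlow : μ ^ 2 ≤ x ^ 2 + (μ - 1) ^ 2 * x) (hup : x ^ 2 ≤ 1 + x)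
    (hJ : 0 ≤ J) (h1 : J ≤ (μ - 1) * q + p) (h2 : x * J ≤ μ * q + (μ - 1) * p) :
    x ^ a * J ≤ (μ - 1) * (a * q + p) + q ∧
      x * (x ^ a * J) ≤ μ * (a * q + p) + (μ - 1) * q := by
  have hn' : (2 : ℝ) ≤ n := by exact_mod_cast hn
  have hμ0 : 0 < μ := by linarith
  obtain ⟨k, rfl⟩ : ∃ k, a = k + 1 := ⟨a - 1, by omega⟩
  obtain ⟨m, rfl⟩ : ∃ m, n = m + 1 := ⟨n - 1, by omega⟩
  have hkm : k ≤ m := by omega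
  have hm : (1 : ℝ) ≤ m := by push_cast at hn'; linarith
  have chord := mul_pow_sub_one_le_mul_pow_sub_one hx hkm
  obtain ⟨t, ht⟩ : ∃ t : ℝ, t = k / m := ⟨_, rfl⟩
  have htm : t * m = k := by rw [ht]; field_simp
  have ht0 : 0 ≤ t := by rw [ht]; positivity
  have ht1 : t ≤ 1 := by
    rw [ht, div_le_one (by linarith)]
    exact_mod_cast hkm
  have hpow : x ^ k ≤ 1 + t * (x ^ m - 1) := by
    rw [← htm] at chord
    have : (m : ℝ) * (x ^ k - 1) ≤ m * (t * (x ^ m - 1)) := by linarith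
    linarith [le_of_mul_le_mul_left this (by linarith)]
  have hxm : x ^ 2 * x ^ m = μ := by rw [← hxμ]; ring
  push_cast at hq hμ ⊢
  have hmμ : (m : ℝ) * μ = μ ^ 2 - 3 * μ + 1 := by linarith
  have hkμ : (k : ℝ) * μ = t * (μ ^ 2 - 3 * μ + 1) := by rw [← htm, ← hmμ]; ring
  have hx0 : 0 < x := by linarith
  constructor
  · have hend : μ * (x * x ^ m - x) ≤ (μ - 1) * (μ - 1 - x) := by
      have : x * (μ * (x * x ^ m - x)) ≤ x * ((μ - 1) * (μ - 1 - x)) := by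
        have : x * (μ * (x * x ^ m - x)) = μ * (μ - x ^ 2) := by rw [← hxm]; ring
        rw [this]
        linarith
      exact le_of_mul_le_mul_left this hx0
    have hpow' : μ * (x * x ^ k) ≤ μ * x + t * ((μ - 1) * (μ - 1 - x)) := by
      have e1 : μ * x * x ^ k ≤ μ * x * (1 + t * (x ^ m - 1)) :=
        mul_le_mul_of_nonneg_left hpow (by positivity)
      have e2 := mul_le_mul_of_nonneg_left hend ht0
      linarith
    have e3 := mul_le_mul_of_nonneg_right hpow' hJ
    have e4 : t * (μ - 1) ^ 2 * J ≤ t * (μ - 1) ^ 2 * ((μ - 1) * q + p) :=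
      mul_le_mul_of_nonneg_left h1 (by positivity)
    have e5 : (μ - t * (μ - 1)) * (x * J) ≤ (μ - t * (μ - 1)) * (μ * q + (μ - 1) * p) :=
      mul_le_mul_of_nonneg_left h2 (by nlinarith)
    refine le_of_mul_le_mul_left ?_ hμ0
    have e6 : μ * ((μ - 1) * ((k + 1) * q + p) + q) =
        t * (μ - 1) ^ 2 * ((μ - 1) * q + p) + (μ - t * (μ - 1)) * (μ * q + (μ - 1) * p) := by
      linear_combination (μ - 1) * q * hkμ
    rw [e6, pow_succ]
    linarith
  · have hpow' : x * (x ^ k * x) ≤ 1 + x + t * (μ - 1 - x) := by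
      have e1 : x ^ 2 * x ^ k ≤ x ^ 2 * (1 + t * (x ^ m - 1)) :=
        mul_le_mul_of_nonneg_left hpow (by positivity)
      have e2 : x ^ 2 * (1 + t * (x ^ m - 1)) = (1 - t) * x ^ 2 + t * μ := by
        rw [← hxm]; ring
      have e3 := mul_le_mul_of_nonneg_left hup (sub_nonneg.2 ht1)
      linarith
    have e3 := mul_le_mul_of_nonneg_right hpow' hJ
    have e4 : (1 + t * (μ - 1)) * J ≤ (1 + t * (μ - 1)) * ((μ - 1) * q + p) :=
      mul_le_mul_of_nonneg_left h1 (by nlinarith)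
    have e5 := mul_le_mul_of_nonneg_left h2 (sub_nonneg.2 ht1)
    have e6 : μ * ((k + 1) * q + p) + (μ - 1) * q =
        (1 + t * (μ - 1)) * ((μ - 1) * q + p) + (1 - t) * (μ * q + (μ - 1) * p) := by
      linear_combination q * hkμ
    rw [e6, pow_succ]
    linarith

/-- A sharper lower bound: the continuant is at least `x ^ (S - 1)` where `x ^ (n + 1) = μ`. -/
theorem pow_sum_le_mul_contnt {n : ℕ} (hn : 2 ≤ n) {μ x : ℝ}
    (hμ : (n : ℝ) + 1 < μ) (hμ' : μ < n + 2) (hq : μ ^ 2 - (n + 2) * μ + 1 = 0) (hx : 1 ≤ x)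
    (hxμ : x ^ (n + 1) = μ) (a : List ℕ) (ha : ∀ y ∈ a, 1 ≤ y ∧ y ≤ n) :
    x ^ a.sum ≤ x * contnt a := by
  have hn' : (2 : ℝ) ≤ n := by exact_mod_cast hn
  have hx0 : 0 < x := by linarith
  have hlow := sq_le_sq_add_mul hn hμ hμ' hq hx0.le hxμ
  have hup : x ^ 2 ≤ 1 + x := by
    by_contra! h
    linarith [add_two_le_pow_succ hx h hn]
  have hroot : μ ≤ (μ - 1) * x := by
    by_contra! h
    have h1 : (μ - 1) * ((μ - 1) * x) < (μ - 1) * μ := mul_lt_mul_of_pos_left h (by linarith)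
    have h2 : x ^ 2 < μ := by nlinarith
    nlinarith
  have main : ∃ p : ℕ, p ≤ contnt a ∧ (∀ b, contnt (b :: a) = b * contnt a + p) ∧
      μ / x * x ^ a.sum ≤ (μ - 1) * contnt a + p ∧
      x * (μ / x * x ^ a.sum) ≤ μ * contnt a + (μ - 1) * p := by
    induction a with
    | nil =>
      refine ⟨0, by simp, by simp [contnt], ?_, ?_⟩
      · simp only [List.sum_nil, pow_zero, contnt]
        push_cast
        rw [mul_one, mul_one, add_zero, div_le_iff₀ hx0]
        exact hroot
      · simp only [List.sum_nil, pow_zero, contnt]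
        push_cast
        field_simp
        linarith
    | cons b l ih =>
      obtain ⟨p, -, hb, h1, h2⟩ := ih fun y hy => ha y (List.mem_cons_of_mem _ hy)
      obtain ⟨hb1, hbn⟩ := ha b List.mem_cons_self
      have step := continuant_step hn hb1 hbn hμ hq hx hxμ hlow hup
        (mul_nonneg (div_nonneg (by linarith) hx0.le) (by positivity)) h1 h2
      have e : x ^ b * (μ / x * x ^ l.sum) = μ / x * x ^ (b :: l).sum := by
        rw [List.sum_cons, pow_add]; ring
      rw [e] at step
      refine ⟨contnt l, ?_, fun d => by simp [contnt], ?_, ?_⟩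
      · rw [hb]; nlinarith
      · rw [hb]; push_cast; exact step.1
      · rw [hb]; push_cast; exact step.2
  obtain ⟨p, hp, -, h1, -⟩ := main
  have hp' : (p : ℝ) ≤ contnt a := by exact_mod_cast hp
  have h3 : μ / x * x ^ a.sum ≤ μ * contnt a := by linarith
  rw [div_mul_eq_mul_div, div_le_iff₀ hx0, mul_assoc] at h3
  linarith [le_of_mul_le_mul_left h3 (by linarith)]

/-- Corollary 1: for `2 ≤ n ≤ S − 2` and
`μ_n = (n + 2 + √(n² + 4n))/2`, every sequence in `U_n(S)` has continuant at
least `μ_n^{(S−n+1)/(n+1)} / e²`. -/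
theorem stmt_7 (n S : ℕ) (hn : 2 ≤ n) (hnS : n + 2 ≤ S)
    (a : List ℕ) (ha : ∀ y ∈ a, 1 ≤ y ∧ y ≤ n) (hsum : a.sum = S) :
    (contnt a : ℝ) ≥
      (((n : ℝ) + 2 + Real.sqrt ((n : ℝ) ^ 2 + 4 * n)) / 2) ^
          (((S : ℝ) - n + 1) / ((n : ℝ) + 1)) / Real.exp 2 := by
  have hn' : (2 : ℝ) ≤ n := by exact_mod_cast hn
  set s := Real.sqrt ((n : ℝ) ^ 2 + 4 * n) with hs
  have hs2 : s ^ 2 = (n : ℝ) ^ 2 + 4 * n := Real.sq_sqrt (by positivity)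
  have hs0 : 0 ≤ s := Real.sqrt_nonneg _
  have hsl : (n : ℝ) < s := by nlinarith
  have hsu : s < n + 2 := by nlinarith
  set μ := ((n : ℝ) + 2 + s) / 2 with hμdef
  have hμ : (n : ℝ) + 1 < μ := by linarith
  have hμ' : μ < n + 2 := by linarith
  have hq : μ ^ 2 - (n + 2) * μ + 1 = 0 := by
    rw [hμdef]; linear_combination hs2 / 4
  have hμ0 : 0 < μ := by linarith
  set x := μ ^ (1 / ((n : ℝ) + 1)) with hxdef
  have hx : 1 ≤ x := Real.one_le_rpow (by linarith) (by positivity)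
  have hx0 : 0 < x := by linarith
  have hxμ : x ^ (n + 1) = μ := by
    rw [hxdef, ← Real.rpow_natCast, ← Real.rpow_mul hμ0.le]
    push_cast
    rw [one_div_mul_cancel (by positivity), Real.rpow_one]
  have hmain := pow_sum_le_mul_contnt hn hμ hμ' hq hx hxμ a ha
  rw [hsum] at hmain
  have hpow : μ ^ (((S : ℝ) - n + 1) / ((n : ℝ) + 1)) ≤ contnt a := by
    have e : μ ^ (((S : ℝ) - n + 1) / ((n : ℝ) + 1)) = x ^ ((S : ℝ) - n + 1) := by
      rw [hxdef, ← Real.rpow_mul hμ0.le]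
      congr 1
      ring
    have h1 : x ^ ((S : ℝ) - n + 1) ≤ x ^ ((S : ℝ) - 1) :=
      Real.rpow_le_rpow_of_exponent_le hx (by linarith)
    have h2 : x ^ ((S : ℝ) - 1) = x ^ S / x := by
      rw [Real.rpow_sub_one hx0.ne', Real.rpow_natCast]
    have h3 : x ^ S / x ≤ contnt a := by
      rw [div_le_iff₀ hx0]; linarith
    linarith
  have h0 : 0 ≤ μ ^ (((S : ℝ) - n + 1) / ((n : ℝ) + 1)) := Real.rpow_nonneg hμ0.le _
  exact (div_le_self h0 (Real.one_le_exp (by norm_num))).trans hpow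
end
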